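/- (Coding theorem for the estimation-induced outage capacity.) Fix 0 < γ < 1, a cost function Γ : 𝒳 → [0,∞) and a budget 𝒫 with 𝒫 ≥ min_{x∈𝒳} Γ(x). Call a rate R ≥ 0 (ε,γ)-achievable if for every δ > 0 and every sufficiently large n there exists a length-n code of size M whose codewords x_m all satisfy ∑_{a∈𝒳} Γ(a) P̂_{x_m}(a) ≤ 𝒫, such that μ(Λ_ε) ≥ 1 − γ and n⁻¹ log M ≥ R − δ. Call R γ-achievable if it is (ε,γ)-achievable for every ε ∈ (0,1), and let C(γ) be the supremum of all γ-achievable rates. Then C(γ) = max over probability mass functions P on 𝒳 with ∑_{a} Γ(a)P(a) ≤ 𝒫 of sup over measurable sets Λ ⊆ Θ with μ(Λ) ≥ 1 − γ of inf_{θ∈Λ} I(P, W(·|·,θ)). -/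

import Mathlib

open scoped BigOperators
open Finset

section Defs

variable {Θ X Y : Type}

/-- Probability of the output set `B` under the `n`-fold memoryless extension
`Wⁿ(B|x,θ) = ∑_{y∈B} ∏ᵢ W(yᵢ|xᵢ,θ)`. -/
noncomputable def Wn [Fintype Y] (W : Θ → X → Y → ℝ) (n : ℕ) (θ : Θ)
    (x : Fin n → X) (B : Finset (Fin n → Y)) : ℝ :=
  ∑ y ∈ B, ∏ i, W θ (x i) (y i)

/-- Empirical probability mass function `P̂ₓ` of a sequence `x ∈ 𝒳ⁿ`. -/
noncomputable def emp [DecidableEq X] (n : ℕ) (x : Fin n → X) (a : X) : ℝ :=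
  ((Finset.univ.filter fun i => x i = a).card : ℝ) / (n : ℝ)

/-- Empirical conditional pmf `Ŵ_{x,y}` of `y` given `x`. -/
noncomputable def empCond [DecidableEq X] [DecidableEq Y] (n : ℕ)
    (x : Fin n → X) (y : Fin n → Y) (a : X) (b : Y) : ℝ :=
  ((Finset.univ.filter fun i => x i = a ∧ y i = b).card : ℝ) /
    ((Finset.univ.filter fun i => x i = a).card : ℝ)

/-- Kullback–Leibler divergence `D(Q‖P)` (real-valued sum; paired with `absCont`
to encode the `+∞` convention). -/
noncomputable def klDiv [Fintype X] (Q P : X → ℝ) : ℝ :=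
  ∑ a, Q a * Real.log (Q a / P a)

/-- Absolute continuity `Q ≪ P` (finiteness of `D(Q‖P)`). -/
def absCont [Fintype X] (Q P : X → ℝ) : Prop := ∀ a, Q a ≠ 0 → P a ≠ 0

/-- Conditional Kullback–Leibler divergence `D(V‖W|P)` (real-valued sum; paired
with `condAbsCont` to encode the `+∞` convention). -/
noncomputable def condKL [Fintype X] [Fintype Y] (P : X → ℝ) (V W : X → Y → ℝ) : ℝ :=
  ∑ a, P a * ∑ b, V a b * Real.log (V a b / W a b)

/-- Conditional absolute continuity (finiteness of `D(V‖W|P)`). -/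
def condAbsCont (P : X → ℝ) (V W : X → Y → ℝ) : Prop :=
  ∀ a b, P a ≠ 0 → V a b ≠ 0 → W a b ≠ 0

/-- Conditional entropy `H(V|P)`. -/
noncomputable def condEnt [Fintype X] [Fintype Y] (P : X → ℝ) (V : X → Y → ℝ) : ℝ :=
  -∑ a, P a * ∑ b, V a b * Real.log (V a b)

/-- Shannon entropy of a pmf on `Y`. -/
noncomputable def ent [Fintype Y] (Q : Y → ℝ) : ℝ := -∑ b, Q b * Real.log (Q b)

/-- Mutual information `I(P, V)`. -/
noncomputable def mutInfo [Fintype X] [Fintype Y] (P : X → ℝ) (V : X → Y → ℝ) : ℝ :=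
  ∑ a, ∑ b, P a * V a b * Real.log (V a b / ∑ a', P a' * V a' b)

/-- `P` is a probability mass function. -/
def IsPM [Fintype X] (P : X → ℝ) : Prop := (∀ a, 0 ≤ P a) ∧ ∑ a, P a = 1

/-- `V` is a channel from `X` to `Y`. -/
def IsChannel [Fintype Y] (V : X → Y → ℝ) : Prop :=
  (∀ a b, 0 ≤ V a b) ∧ ∀ a, ∑ b, V a b = 1

open scoped Classical in
/-- I-typical input sequences `T_Pⁿ(δ) = {x : D(P̂ₓ‖P) ≤ δ}`. -/
noncomputable def typX [Fintype X] [DecidableEq X] (P : X → ℝ) (n : ℕ) (δ : ℝ) :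
    Finset (Fin n → X) :=
  Finset.univ.filter fun x => absCont (emp n x) P ∧ klDiv (emp n x) P ≤ δ

open scoped Classical in
/-- Conditionally I-typical output sequences `T_Vⁿ(x, δ) = {y : D(Ŵ_{x,y}‖V|P̂ₓ) ≤ δ}`. -/
noncomputable def typY [Fintype X] [Fintype Y] [DecidableEq X] [DecidableEq Y]
    (V : X → Y → ℝ) (n : ℕ) (x : Fin n → X) (δ : ℝ) : Finset (Fin n → Y) :=
  Finset.univ.filter fun y =>
    condAbsCont (emp n x) (empCond n x y) V ∧ condKL (emp n x) (empCond n x y) V ≤ δ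

open scoped Classical in
/-- Robust I-typical set `B_Λⁿ(x, δ) = ⋃_{θ∈Λ} T_{W_θ}ⁿ(x, δ)`. -/
noncomputable def robustTyp [Fintype X] [Fintype Y] [DecidableEq X] [DecidableEq Y]
    (W : Θ → X → Y → ℝ) (n : ℕ) (Λ : Set Θ) (x : Fin n → X) (δ : ℝ) :
    Finset (Fin n → Y) :=
  Finset.univ.filter fun y => ∃ θ ∈ Λ, y ∈ typY (W θ) n x δ

/-- The set `Λ_ε` of channel states at which the maximal error probability of the
code `(c, D)` is at most `ε`. -/
def lambdaSet [Fintype X] [Fintype Y] [DecidableEq X] [DecidableEq Y]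
    (W : Θ → X → Y → ℝ) {n M : ℕ}
    (c : Fin M → Fin n → X) (D : Fin M → Finset (Fin n → Y)) (ε : ℝ) : Set Θ :=
  {θ | ∀ m, Wn W n θ (c m) (D m)ᶜ ≤ ε}

/-- Minimal cardinality `g_Λ(A, η)` of a common `η`-image of `A` via `𝒲_Λ`. -/
noncomputable def gMin [Fintype X] [Fintype Y] (W : Θ → X → Y → ℝ) (n : ℕ)
    (Λ : Set Θ) (A : Finset (Fin n → X)) (η : ℝ) : ℕ :=
  sInf {k : ℕ | ∃ B : Finset (Fin n → Y), B.card = k ∧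
    ∀ x ∈ A, ∀ θ ∈ Λ, η ≤ Wn W n θ x B}

/-- `H(𝒲_Λ|P) = sup_{θ∈Λ} H(W_θ|P)`. -/
noncomputable def entSup [Fintype X] [Fintype Y] (W : Θ → X → Y → ℝ) (Λ : Set Θ)
    (P : X → ℝ) : ℝ :=
  sSup ((fun θ => condEnt P (W θ)) '' Λ)

/-- The set `𝒫_n(𝒴|𝒳)` of empirical conditional pmfs of length-`n` pairs. -/
def empCondSet (X Y : Type) [DecidableEq X] [DecidableEq Y] (n : ℕ) :
    Set (X → Y → ℝ) :=
  {V | ∃ (x : Fin n → X) (y : Fin n → Y), V = fun a b => empCond n x y a b}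

/-- `F` is a relatively τ₀-open subset of `F ∪ Pn`: every `V ∈ F` has a
total-variation neighborhood whose intersection with `Pn` is contained in `F`. -/
def relOpen (F Pn : Set (X → Y → ℝ)) : Prop :=
  ∀ V ∈ F, ∃ r > 0, ∀ V' ∈ Pn, (∀ a b, |V' a b - V a b| < r) → V' ∈ F

/-- A δ-sequence: `δ_n → 0` and `√n · δ_n → ∞`. -/
def IsDeltaSeq (δseq : ℕ → ℝ) : Prop :=
  Filter.Tendsto δseq Filter.atTop (nhds 0) ∧
    Filter.Tendsto (fun n : ℕ => Real.sqrt n * δseq n) Filter.atTop Filter.atTop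

open scoped Classical in
/-- Union over `V ∈ F` of exact conditional type classes `T_Vⁿ(x)`. -/
noncomputable def exactUnion [Fintype X] [Fintype Y] [DecidableEq X] [DecidableEq Y]
    (F : Set (X → Y → ℝ)) (n : ℕ) (x : Fin n → X) : Finset (Fin n → Y) :=
  Finset.univ.filter fun y => ∃ V ∈ F, ∀ a b, empCond n x y a b = V a b

open scoped Classical in
/-- Union over `V ∈ F` of divergence shells `T_Vⁿ(x, ε)`. -/
noncomputable def shellUnion [Fintype X] [Fintype Y] [DecidableEq X] [DecidableEq Y]
    (F : Set (X → Y → ℝ)) (n : ℕ) (x : Fin n → X) (ε : ℝ) : Finset (Fin n → Y) :=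
  Finset.univ.filter fun y => ∃ V ∈ F, y ∈ typY V n x ε

/-- The capacity expression `𝒞(γ, P) = sup_{Λ : μ(Λ) ≥ 1-γ} inf_{θ∈Λ} I(P, W_θ)`. -/
noncomputable def ratesFormula [Fintype X] [Fintype Y] [MeasurableSpace Θ]
    (μ : MeasureTheory.Measure Θ) (W : Θ → X → Y → ℝ) (γ : ℝ) (P : X → ℝ) : ℝ :=
  sSup {r : ℝ | ∃ Λ : Set Θ, MeasurableSet Λ ∧ ENNReal.ofReal (1 - γ) ≤ μ Λ ∧
    r = sInf ((fun θ => mutInfo P (W θ)) '' Λ)}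

/-- A rate `R` is `(ε,γ)`-achievable: for every `δ > 0` and all sufficiently
large `n` there is a length-`n` code of size `M`, with all codewords satisfying
the cost constraint, such that `μ(Λ_ε) ≥ 1-γ` and `n⁻¹ log M ≥ R - δ`. -/
def Achievable [Fintype X] [Fintype Y] [DecidableEq X] [DecidableEq Y] [MeasurableSpace Θ]
    (μ : MeasureTheory.Measure Θ) (W : Θ → X → Y → ℝ) (Γ : X → ℝ)
    (Pbudget γ ε R : ℝ) : Prop :=
  ∀ δ : ℝ, 0 < δ → ∃ N : ℕ, ∀ n : ℕ, N ≤ n →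
    ∃ (M : ℕ) (c : Fin M → Fin n → X) (D : Fin M → Finset (Fin n → Y)),
      0 < M ∧
      (∀ m, ∑ a, Γ a * emp n (c m) a ≤ Pbudget) ∧
      (∀ m m', m ≠ m' → Disjoint (D m) (D m')) ∧
      ENNReal.ofReal (1 - γ) ≤ μ (lambdaSet W c D ε) ∧
      R - δ ≤ (n : ℝ)⁻¹ * Real.log M

end Defs

theorem sum_prod_apply {α : Type*} [Fintype α] {n : ℕ} (g : Fin n → α → ℝ) :
    ∑ x : Fin n → α, ∏ i, g i (x i) = ∏ i, ∑ a, g i a := by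
  rw [Finset.prod_univ_sum, Fintype.piFinset_univ]

theorem sum_sum_prod_apply {α β : Type*} [Fintype α] [Fintype β] {n : ℕ} (g : α → β → ℝ) :
    ∑ x : Fin n → α, ∑ y : Fin n → β, ∏ i, g (x i) (y i) = (∑ a, ∑ b, g a b) ^ n := by
  simp_rw [sum_prod_apply (fun i => g (_ : α)), sum_prod_apply (fun _ a => ∑ b, g a b)]
  simp

/-- The expectation of an additive functional under a product law. -/
theorem sum_prod_mul_sum {β : Type*} [Fintype β] {n : ℕ} (v g : Fin n → β → ℝ)
    (hv : ∀ i, ∑ b, v i b = 1) :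
    ∑ y : Fin n → β, (∏ i, v i (y i)) * ∑ i, g i (y i) = ∑ i, ∑ b, v i b * g i b := by
  simp_rw [Finset.mul_sum]
  rw [Finset.sum_comm]
  refine Finset.sum_congr rfl fun i _ => ?_
  have h (y : Fin n → β) : (∏ j, v j (y j)) * g i (y i) =
      ∏ j, v j (y j) * (if j = i then g i (y j) else 1) := by
    rw [Finset.prod_mul_distrib, Finset.prod_ite_eq' Finset.univ i (fun j => g i (y j))]
    simp
  simp_rw [h]
  rw [sum_prod_apply (fun j b => v j b * (if j = i then g i b else 1)),
    Finset.prod_eq_single i]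
  · simp
  · intro j _ hj
    simp [hj, hv]
  · simp

theorem sum_abs_prod_sub_prod_le {β : Type*} [Fintype β] :
    ∀ {n : ℕ} (p q : Fin n → β → ℝ), (∀ i b, 0 ≤ p i b) → (∀ i b, 0 ≤ q i b) →
      (∀ i, ∑ b, p i b = 1) → (∀ i, ∑ b, q i b = 1) →
      ∑ y : Fin n → β, |∏ i, p i (y i) - ∏ i, q i (y i)| ≤ ∑ i, ∑ b, |p i b - q i b|
  | 0, p, q, _, _, _, _ => by simp
  | n + 1, p, q, hp, hq, hp1, hq1 => by
    have ih := sum_abs_prod_sub_prod_le (fun i => p (Fin.succ i)) (fun i => q (Fin.succ i))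
      (fun i => hp _) (fun i => hq _) (fun i => hp1 _) (fun i => hq1 _)
    rw [← (Fin.consEquiv fun _ : Fin (n + 1) => β).sum_comp, Fintype.sum_prod_type]
    simp only [Fin.consEquiv_apply, Fin.prod_univ_succ, Fin.cons_zero, Fin.cons_succ,
      Fin.sum_univ_succ]
    have hterm (b : β) (y : Fin n → β) :
        |p 0 b * ∏ i : Fin n, p i.succ (y i) - q 0 b * ∏ i : Fin n, q i.succ (y i)| ≤
          |p 0 b - q 0 b| * ∏ i : Fin n, p i.succ (y i) +
            q 0 b * |∏ i : Fin n, p i.succ (y i) - ∏ i : Fin n, q i.succ (y i)| := by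
      have h := abs_add_le ((p 0 b - q 0 b) * ∏ i : Fin n, p i.succ (y i))
        (q 0 b * (∏ i : Fin n, p i.succ (y i) - ∏ i : Fin n, q i.succ (y i)))
      rw [abs_mul, abs_mul, abs_of_nonneg (hq 0 b),
        abs_of_nonneg (Finset.prod_nonneg fun i _ => hp (Fin.succ i) (y i))] at h
      refine le_trans (le_of_eq ?_) h
      congr 1
      ring
    calc _ ≤ ∑ b, ∑ y : Fin n → β, (|p 0 b - q 0 b| * ∏ i : Fin n, p i.succ (y i) +
            q 0 b * |∏ i : Fin n, p i.succ (y i) - ∏ i : Fin n, q i.succ (y i)|) :=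
          Finset.sum_le_sum fun b _ => Finset.sum_le_sum fun y _ => hterm b y
      _ = (∑ b, |p 0 b - q 0 b|) +
            ∑ y : Fin n → β, |∏ i : Fin n, p i.succ (y i) - ∏ i : Fin n, q i.succ (y i)| := by
          simp_rw [Finset.sum_add_distrib, ← Finset.mul_sum,
            sum_prod_apply (fun i : Fin n => p i.succ)]
          simp [hp1, ← Finset.sum_mul, hq1]
      _ ≤ _ := by gcongr

/-- Gibbs' inequality. -/
theorem sum_mul_log_div_nonneg {ι : Type*} [Fintype ι] {p q : ι → ℝ} (hp : ∀ i, 0 ≤ p i)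
    (hq : ∀ i, 0 ≤ q i) (hpq : ∀ i, p i ≠ 0 → q i ≠ 0) (h : ∑ i, q i ≤ ∑ i, p i) :
    0 ≤ ∑ i, p i * Real.log (p i / q i) := by
  calc 0 ≤ ∑ i, (p i - q i) := by rw [Finset.sum_sub_distrib]; linarith
    _ ≤ _ := Finset.sum_le_sum fun i _ => ?_
  by_cases hi : p i = 0
  · simp [hi, hq i]
  have hp' : 0 < p i := (hp i).lt_of_ne' hi
  have hq' : 0 < q i := (hq i).lt_of_ne' (hpq i hi)
  have := mul_le_mul_of_nonneg_left (Real.one_sub_inv_le_log_of_pos (div_pos hp' hq')) hp'.le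
  refine le_trans (le_of_eq ?_) this
  field_simp

theorem exp_le_one_add_add_sq_mul {u : ℝ} : Real.exp u ≤ 1 + u + u ^ 2 * max 1 (Real.exp u) := by
  rcases le_total u 0 with hu | hu
  · rw [max_eq_left (Real.exp_le_one_iff.2 hu)]
    have h1 := Real.add_one_le_exp (-u)
    have h2 : Real.exp u * Real.exp (-u) = 1 := by rw [← Real.exp_add]; simp
    have h3 := Real.exp_pos u
    have h4 : Real.exp u * (1 - u) ≤ 1 := by nlinarith
    have h5 : 1 ≤ (1 + u + u ^ 2 * 1) * (1 - u) := by nlinarith [pow_nonneg (neg_nonneg.2 hu) 3]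
    exact le_of_mul_le_mul_right (h4.trans h5) (by linarith)
  · rw [max_eq_right (Real.one_le_exp hu)]
    have h1 := Real.add_one_le_exp (-u)
    have h2 : Real.exp u * Real.exp (-u) = 1 := by rw [← Real.exp_add]; simp
    have h3 := Real.exp_pos u
    have h4 : Real.exp u * (1 - u) ≤ 1 := by nlinarith
    nlinarith

theorem log_sq_le_sqrt {z : ℝ} (hz : 1 ≤ z) : Real.log z ^ 2 ≤ 16 * z ^ (1 / 2 : ℝ) := by
  have hz0 : 0 < z := by linarith
  have h := Real.log_le_rpow_div hz0.le (show (0 : ℝ) < 1 / 4 by norm_num)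
  calc Real.log z ^ 2 ≤ (z ^ (1 / 4 : ℝ) / (1 / 4)) ^ 2 := by
        gcongr; exact Real.log_nonneg hz
    _ = 16 * (z ^ (1 / 4 : ℝ) * z ^ (1 / 4 : ℝ)) := by ring
    _ = _ := by rw [← Real.rpow_add hz0]; norm_num

theorem mul_rpow_le {p z s : ℝ} (hp : 0 < p) (hz : 0 < z) (hpz : p * z ≤ 1) (hpz' : p ≤ z)
    (hs : 0 ≤ s) (hs' : s ≤ 1 / 2) :
    p * z ^ s ≤ p + s * (p * Real.log z) + 16 * s ^ 2 := by
  have key : p * Real.log z ^ 2 * max 1 (z ^ s) ≤ 16 := by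
    rcases le_total 1 z with h1 | h1
    · rw [max_eq_right (Real.one_le_rpow h1 hs)]
      calc p * Real.log z ^ 2 * z ^ s ≤ z⁻¹ * (16 * z ^ (1 / 2 : ℝ)) * z ^ (1 / 2 : ℝ) := by
            gcongr
            · rwa [← one_div, le_div_iff₀ hz]
            · exact log_sq_le_sqrt h1
        _ = 16 * (z⁻¹ * (z ^ (1 / 2 : ℝ) * z ^ (1 / 2 : ℝ))) := by ring
        _ = 16 := by rw [← Real.rpow_add hz]; norm_num; field_simp
    · rw [max_eq_left (Real.rpow_le_one hz.le h1 hs), mul_one]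
      have h2 := log_sq_le_sqrt ((one_le_inv₀ hz).2 h1)
      rw [Real.log_inv, neg_sq] at h2
      have h3 : (z⁻¹) ^ (1 / 2 : ℝ) ≤ z⁻¹ := by
        simpa using Real.rpow_le_rpow_of_exponent_le ((one_le_inv₀ hz).2 h1)
          (show (1 / 2 : ℝ) ≤ 1 by norm_num)
      calc p * Real.log z ^ 2 ≤ z * (16 * z⁻¹) := by
            gcongr; linarith
        _ = 16 := by field_simp
  have h := exp_le_one_add_add_sq_mul (u := Real.log z * s)
  rw [← Real.rpow_def_of_pos hz] at h
  have h2 := mul_le_mul_of_nonneg_left h hp.le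
  have h3 := mul_le_mul_of_nonneg_left key (sq_nonneg s)
  nlinarith

theorem IsChannel.le_one {X Y : Type} [Fintype Y] {V : X → Y → ℝ} (hV : IsChannel V)
    (a : X) (b : Y) : V a b ≤ 1 :=
  hV.2 a ▸ Finset.single_le_sum (fun b _ => hV.1 a b) (Finset.mem_univ b)

theorem sum_mul_log_div_channel_nonneg {X Y : Type} [Fintype Y] {V : X → Y → ℝ}
    (hV : IsChannel V) {q : Y → ℝ} (hq : ∀ b, 0 ≤ q b)
    (hq1 : ∑ b, q b = 1) {a : X} (h : ∀ b, V a b ≠ 0 → q b ≠ 0) :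
    0 ≤ ∑ b, V a b * Real.log (V a b / q b) :=
  sum_mul_log_div_nonneg (hV.1 a) hq h (by rw [hq1, hV.2])

section MutualInformation

variable {X Y : Type} [Fintype X] [Fintype Y]

/-- The output law `PV` on `Y` of the channel `V` under the input law `P`. -/
noncomputable def outLaw (P : X → ℝ) (V : X → Y → ℝ) (b : Y) : ℝ := ∑ a, P a * V a b

variable {P : X → ℝ} {V : X → Y → ℝ}

theorem IsPM.le_one (hP : IsPM P) (a : X) : P a ≤ 1 :=
  hP.2 ▸ Finset.single_le_sum (fun a _ => hP.1 a) (Finset.mem_univ a)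

theorem outLaw_nonneg (hP : IsPM P) (hV : IsChannel V) (b : Y) : 0 ≤ outLaw P V b :=
  Finset.sum_nonneg fun a _ => mul_nonneg (hP.1 a) (hV.1 a b)

theorem sum_outLaw (hP : IsPM P) (hV : IsChannel V) : ∑ b, outLaw P V b = 1 := by
  unfold outLaw
  rw [Finset.sum_comm]
  simp_rw [← Finset.mul_sum, hV.2, mul_one, hP.2]

theorem le_outLaw (hP : IsPM P) (hV : IsChannel V) (a : X) (b : Y) :
    P a * V a b ≤ outLaw P V b :=
  Finset.single_le_sum (f := fun a => P a * V a b)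
    (fun a _ => mul_nonneg (hP.1 a) (hV.1 a b)) (Finset.mem_univ a)

theorem outLaw_le_one (hP : IsPM P) (hV : IsChannel V) (b : Y) : outLaw P V b ≤ 1 :=
  sum_outLaw hP hV ▸
    Finset.single_le_sum (fun b _ => outLaw_nonneg hP hV b) (Finset.mem_univ b)

theorem outLaw_ne_zero (hP : IsPM P) (hV : IsChannel V) {a : X} {b : Y} (ha : P a ≠ 0)
    (hb : V a b ≠ 0) : outLaw P V b ≠ 0 :=
  ((mul_pos ((hP.1 a).lt_of_ne' ha) ((hV.1 a b).lt_of_ne' hb)).trans_le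
    (le_outLaw hP hV a b)).ne'

theorem mutInfo_eq_sum_mul (P : X → ℝ) (V : X → Y → ℝ) :
    mutInfo P V = ∑ a, P a * ∑ b, V a b * Real.log (V a b / outLaw P V b) := by
  simp_rw [Finset.mul_sum, ← mul_assoc]
  rfl

theorem mutInfo_nonneg (hP : IsPM P) (hV : IsChannel V) : 0 ≤ mutInfo P V := by
  rw [mutInfo_eq_sum_mul]
  refine Finset.sum_nonneg fun a _ => ?_
  by_cases ha : P a = 0
  · simp [ha]
  · exact mul_nonneg (hP.1 a) (sum_mul_log_div_channel_nonneg hV (outLaw_nonneg hP hV)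
      (sum_outLaw hP hV) fun b hb => outLaw_ne_zero hP hV ha hb)

theorem mutInfo_le_card (hP : IsPM P) (hV : IsChannel V) :
    mutInfo P V ≤ Fintype.card X * Fintype.card Y := by
  have h (a : X) (b : Y) : P a * V a b * Real.log (V a b / outLaw P V b) ≤ 1 := by
    by_cases ha : P a = 0
    · simp [ha]
    by_cases hb : V a b = 0
    · simp [hb]
    have hq : 0 < outLaw P V b := (outLaw_nonneg hP hV b).lt_of_ne' (outLaw_ne_zero hP hV ha hb)
    have hb' : 0 < V a b := (hV.1 a b).lt_of_ne' hb
    calc P a * V a b * Real.log (V a b / outLaw P V b)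
        ≤ P a * V a b * (V a b / outLaw P V b) := by
          gcongr
          · exact mul_nonneg (hP.1 a) hb'.le
          · linarith [Real.log_le_sub_one_of_pos (div_pos hb' hq)]
      _ = (P a * V a b / outLaw P V b) * V a b := by ring
      _ ≤ 1 * 1 := mul_le_mul (div_le_one_of_le₀ (le_outLaw hP hV a b) hq.le) (hV.le_one a b)
          hb'.le zero_le_one
      _ = 1 := one_mul 1
  calc mutInfo P V ≤ ∑ _a : X, ∑ _b : Y, (1 : ℝ) :=
        Finset.sum_le_sum fun a _ => Finset.sum_le_sum fun b _ => h a b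
    _ = _ := by simp

theorem le_mutInfo_mix {P' : X → ℝ} (hP : IsPM P) (hP' : IsPM P') (hV : IsChannel V) {t : ℝ}
    (ht0 : 0 < t) (ht : ∀ a, t * P a ≤ P' a) : t * mutInfo P V ≤ mutInfo P' V := by
  have hne (a : X) (ha : P a ≠ 0) : P' a ≠ 0 :=
    ((mul_pos ht0 ((hP.1 a).lt_of_ne' ha)).trans_le (ht a)).ne'
  have h1 : ∑ a, t * P a * ∑ b, V a b * Real.log (V a b / outLaw P' V b) ≤ mutInfo P' V := by
    rw [mutInfo_eq_sum_mul]
    refine Finset.sum_le_sum fun a _ => ?_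
    by_cases ha : P' a = 0
    · have : P a = 0 := by_contra fun h => hne a h ha
      simp [ha, this]
    · exact mul_le_mul_of_nonneg_right (ht a) (sum_mul_log_div_channel_nonneg hV
        (outLaw_nonneg hP' hV) (sum_outLaw hP' hV) fun b hb => outLaw_ne_zero hP' hV ha hb)
  have hne' (b : Y) (hb : outLaw P V b ≠ 0) : outLaw P' V b ≠ 0 := by
    obtain ⟨a, -, ha⟩ := Finset.exists_ne_zero_of_sum_ne_zero hb
    exact outLaw_ne_zero hP' hV (hne a (left_ne_zero_of_mul ha)) (right_ne_zero_of_mul ha)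
  have h2 : 0 ≤ ∑ b, outLaw P V b * Real.log (outLaw P V b / outLaw P' V b) :=
    sum_mul_log_div_nonneg (outLaw_nonneg hP hV) (outLaw_nonneg hP' hV) hne'
      (by rw [sum_outLaw hP hV, sum_outLaw hP' hV])
  have h3 : ∑ a, P a * ∑ b, V a b * Real.log (V a b / outLaw P' V b) =
      mutInfo P V + ∑ b, outLaw P V b * Real.log (outLaw P V b / outLaw P' V b) := by
    simp_rw [mutInfo_eq_sum_mul]
    conv_rhs => rw [← sub_neg_eq_add, ← Finset.sum_neg_distrib]
    rw [eq_sub_iff_add_eq, ← eq_sub_iff_add_eq']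
    simp_rw [Finset.mul_sum]
    rw [← Finset.sum_sub_distrib]
    simp_rw [← Finset.sum_sub_distrib]
    rw [Finset.sum_comm]
    refine Finset.sum_congr rfl fun b _ => ?_
    rw [outLaw, ← neg_mul, ← Finset.sum_neg_distrib, Finset.sum_mul]
    refine Finset.sum_congr rfl fun a _ => ?_
    by_cases ha : P a = 0
    · simp [ha]
    by_cases hb : V a b = 0
    · simp [hb]
    have hq := outLaw_ne_zero hP hV ha hb
    have hq' := hne' b hq
    change -(P a * V a b) * Real.log (outLaw P V b / outLaw P' V b) =
      P a * (V a b * Real.log (V a b / outLaw P V b)) - _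
    rw [Real.log_div hb hq, Real.log_div hb hq', Real.log_div hq hq']
    ring
  simp_rw [mul_assoc, ← Finset.mul_sum] at h1
  rw [h3] at h1
  nlinarith

theorem sum_mul_rpow_le_exp (hP : IsPM P) (hV : IsChannel V) {s : ℝ} (hs : 0 ≤ s)
    (hs' : s ≤ 1 / 2) :
    ∑ a, ∑ b, P a * V a b * (outLaw P V b / V a b) ^ s ≤
      Real.exp (-(s * mutInfo P V - 16 * (Fintype.card X * Fintype.card Y) * s ^ 2)) := by
  have h (a : X) (b : Y) : P a * V a b * (outLaw P V b / V a b) ^ s ≤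
      P a * V a b - s * (P a * V a b * Real.log (V a b / outLaw P V b)) + 16 * s ^ 2 := by
    by_cases ha : P a = 0
    · simp [ha]; positivity
    by_cases hb : V a b = 0
    · simp [hb]; positivity
    have hq : 0 < outLaw P V b := (outLaw_nonneg hP hV b).lt_of_ne' (outLaw_ne_zero hP hV ha hb)
    have ha' : 0 < P a := (hP.1 a).lt_of_ne' ha
    have hb' : 0 < V a b := (hV.1 a b).lt_of_ne' hb
    have := mul_rpow_le (mul_pos ha' hb') (div_pos hq hb') (s := s) ?_ ?_ hs hs'
    · have hl : Real.log (V a b / outLaw P V b) = -Real.log (outLaw P V b / V a b) := by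
        rw [← Real.log_inv, inv_div]
      rw [hl]
      linarith
    · calc P a * V a b * (outLaw P V b / V a b) = P a * outLaw P V b := by field_simp
        _ ≤ 1 * 1 := mul_le_mul (hP.le_one a) (outLaw_le_one hP hV b) hq.le zero_le_one
        _ = 1 := one_mul 1
    · rw [le_div_iff₀ hb']
      exact (mul_le_of_le_one_right (mul_pos ha' hb').le (hV.le_one a b)).trans
        (le_outLaw hP hV a b)
  calc _ ≤ ∑ a, ∑ b, (P a * V a b - s * (P a * V a b * Real.log (V a b / outLaw P V b)) +
          16 * s ^ 2) := Finset.sum_le_sum fun a _ => Finset.sum_le_sum fun b _ => h a b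
    _ = -(s * mutInfo P V - 16 * (Fintype.card X * Fintype.card Y) * s ^ 2) + 1 := by
        have hI : ∑ a, ∑ b, P a * V a b * Real.log (V a b / outLaw P V b) = mutInfo P V := rfl
        simp_rw [Finset.sum_add_distrib, Finset.sum_sub_distrib, ← Finset.mul_sum, hV.2, hI]
        simp [hP.2]
        ring
    _ ≤ _ := Real.add_one_le_exp _

end MutualInformation

section Converse

variable {X Y : Type} [Fintype X] [DecidableEq X]

theorem mul_sum_mul_emp {n : ℕ} (hn : 0 < n) (x : Fin n → X) (f : X → ℝ) :
    n * ∑ a, f a * emp n x a = ∑ i, f (x i) := by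
  rw [← Finset.sum_fiberwise' Finset.univ x f, Finset.mul_sum]
  refine Finset.sum_congr rfl fun a _ => ?_
  have : (n : ℝ) ≠ 0 := by positivity
  rw [Finset.sum_const, nsmul_eq_mul, emp]
  field_simp

/-- The average of the empirical laws of the codewords `c`. -/
noncomputable def codeLaw {n M : ℕ} (c : Fin M → Fin n → X) (a : X) : ℝ :=
  (M : ℝ)⁻¹ * ∑ m, emp n (c m) a

theorem sum_mul_codeLaw {n M : ℕ} (c : Fin M → Fin n → X) (f : X → ℝ) :
    ∑ a, f a * codeLaw c a = (M : ℝ)⁻¹ * ∑ m, ∑ a, f a * emp n (c m) a := by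
  rw [Finset.sum_comm, Finset.mul_sum]
  refine Finset.sum_congr rfl fun a _ => ?_
  rw [codeLaw, Finset.mul_sum, Finset.mul_sum, Finset.mul_sum]
  exact Finset.sum_congr rfl fun m _ => by ring

theorem isPM_codeLaw {n M : ℕ} (hn : 0 < n) (hM : 0 < M) (c : Fin M → Fin n → X) :
    IsPM (codeLaw c) := by
  have hn' : (n : ℝ) ≠ 0 := by positivity
  have hM' : (M : ℝ) ≠ 0 := by positivity
  refine ⟨fun a => mul_nonneg (by positivity) (Finset.sum_nonneg fun m _ => ?_), ?_⟩
  · unfold emp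
    positivity
  · have h (m : Fin M) : ∑ a, emp n (c m) a = 1 := by
      have := mul_sum_mul_emp hn (c m) fun _ => 1
      simpa [hn'] using this
    simpa [h, hM'] using sum_mul_codeLaw c fun _ => 1

variable [Fintype Y] {V : X → Y → ℝ}

/-- A Fano-type bound on the size of a code whose error probabilities over `V` are at most `ε`. -/
theorem log_card_le_of_error_le (hV : IsChannel V) {n M : ℕ} (hn : 0 < n) (hM : 0 < M)
    [DecidableEq Y] (c : Fin M → Fin n → X) (D : Fin M → Finset (Fin n → Y))
    (hD : ∀ m m', m ≠ m' → Disjoint (D m) (D m')) {ε : ℝ}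
    (hε : ∀ m, ∑ y ∈ (D m)ᶜ, ∏ i, V (c m i) (y i) ≤ ε) :
    (1 - ε) * Real.log M ≤ n * mutInfo (codeLaw c) V + Real.log 2 := by
  have hP := isPM_codeLaw hn hM c
  set q := outLaw (codeLaw c) V with hq
  set g : X → Y → ℝ := fun a b => Real.log (V a b / q b) with hg
  have hM0 : (0 : ℝ) < M := by exact_mod_cast hM
  have hM1 : (1 : ℝ) ≤ M := by exact_mod_cast hM
  have hv0 (m : Fin M) (y : Fin n → Y) : 0 ≤ ∏ i, V (c m i) (y i) :=
    Finset.prod_nonneg fun i _ => hV.1 _ _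
  have hQ0 (y : Fin n → Y) : 0 ≤ ∏ i, q (y i) :=
    Finset.prod_nonneg fun i _ => outLaw_nonneg hP hV _
  have hc (m : Fin M) (i : Fin n) : codeLaw c (c m i) ≠ 0 := by
    refine (mul_pos (inv_pos.2 hM0) ?_).ne'
    refine Finset.sum_pos' (fun m _ => by unfold emp; positivity) ⟨m, Finset.mem_univ _, ?_⟩
    refine div_pos ?_ (by positivity)
    exact_mod_cast Finset.card_pos.2 ⟨i, by simp⟩
  have hpt (m : Fin M) (y : Fin n → Y) :
      (∏ i, V (c m i) (y i)) * (if y ∈ D m then Real.log M else 0) -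
          (∏ i, V (c m i) (y i)) * ∑ i, g (c m i) (y i) ≤
        (∏ i, q (y i)) * (1 + if y ∈ D m then (M : ℝ) else 0) / 2 - (∏ i, V (c m i) (y i)) +
          (∏ i, V (c m i) (y i)) * Real.log 2 := by
    rcases (hv0 m y).eq_or_lt with h0 | h0
    · rw [← h0]
      have : 0 ≤ (∏ i, q (y i)) * (1 + if y ∈ D m then (M : ℝ) else 0) / 2 := by
        have := hQ0 y
        positivity
      simpa using this
    have hVi (i : Fin n) : V (c m i) (y i) ≠ 0 := (Finset.prod_ne_zero_iff.1 h0.ne') i (by simp)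
    have hqi (i : Fin n) : q (y i) ≠ 0 := outLaw_ne_zero hP hV (hc m i) (hVi i)
    have hQ : 0 < ∏ i, q (y i) :=
      (hQ0 y).lt_of_ne' (Finset.prod_ne_zero_iff.2 fun i _ => hqi i)
    have hsum : ∑ i, g (c m i) (y i) =
        Real.log (∏ i, V (c m i) (y i)) - Real.log (∏ i, q (y i)) := by
      rw [Real.log_prod (fun i _ => hVi i), Real.log_prod (fun i _ => hqi i),
        ← Finset.sum_sub_distrib]
      exact Finset.sum_congr rfl fun i _ => Real.log_div (hVi i) (hqi i)
    obtain ⟨E, hE0, hE, hEle⟩ : ∃ E : ℝ, 0 < E ∧ Real.log E = (if y ∈ D m then Real.log M else 0) ∧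
        E ≤ 1 + if y ∈ D m then (M : ℝ) else 0 := by
      by_cases hy : y ∈ D m
      · exact ⟨M, hM0, by simp [hy], by simp [hy]⟩
      · exact ⟨1, one_pos, by simp [hy], by simp [hy]⟩
    rw [← hE, hsum]
    have hlog := Real.log_le_sub_one_of_pos
      (div_pos (mul_pos hQ hE0) (mul_pos two_pos h0))
    rw [Real.log_div (by positivity) (by positivity), Real.log_mul hQ.ne' hE0.ne',
      Real.log_mul two_ne_zero h0.ne'] at hlog
    have h1 := mul_le_mul_of_nonneg_left hlog h0.le
    have h2 : (∏ i, V (c m i) (y i)) * ((∏ i, q (y i)) * E / (2 * ∏ i, V (c m i) (y i)) - 1) =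
        (∏ i, q (y i)) * E / 2 - ∏ i, V (c m i) (y i) := by
      field_simp
    have h3 := mul_le_mul_of_nonneg_left hEle hQ.le
    nlinarith
  have hv1 (m : Fin M) : ∑ y : Fin n → Y, ∏ i, V (c m i) (y i) = 1 := by
    rw [sum_prod_apply fun i => V (c m i)]
    simp [hV.2]
  have hQ1 : ∑ y : Fin n → Y, ∏ i, q (y i) = 1 := by
    rw [sum_prod_apply fun _ => q]
    simp [hq, sum_outLaw hP hV]
  have hsucc (m : Fin M) : (1 - ε) * Real.log M ≤
      ∑ y, (∏ i, V (c m i) (y i)) * (if y ∈ D m then Real.log M else 0) := by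
    have := Finset.sum_compl_add_sum (D m) fun y => ∏ i, V (c m i) (y i)
    simp only [mul_ite, mul_zero, Finset.sum_ite_mem, Finset.univ_inter, ← Finset.sum_mul]
    exact mul_le_mul_of_nonneg_right (by linarith [hε m, hv1 m]) (Real.log_nonneg hM1)
  have hinfo : ∑ m, ∑ y : Fin n → Y, (∏ i, V (c m i) (y i)) * ∑ i, g (c m i) (y i) =
      M * (n * mutInfo (codeLaw c) V) := by
    have h1 (m : Fin M) : ∑ y : Fin n → Y, (∏ i, V (c m i) (y i)) * ∑ i, g (c m i) (y i) =
        n * ∑ a, (∑ b, V a b * g a b) * emp n (c m) a := by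
      rw [sum_prod_mul_sum (fun i => V (c m i)) (fun i => g (c m i)) fun i => hV.2 _,
        mul_sum_mul_emp hn (c m) fun a => ∑ b, V a b * g a b]
    have h2 := sum_mul_codeLaw c fun a => ∑ b, V a b * g a b
    simp_rw [h1, ← Finset.mul_sum]
    rw [mutInfo_eq_sum_mul, ← hq]
    simp_rw [mul_comm (codeLaw c _)]
    rw [h2]
    field_simp
  have hdis : ∑ m, ∑ y ∈ D m, ∏ i, q (y i) ≤ 1 := by
    rw [← Finset.sum_biUnion fun m _ m' _ h => hD m m' h, ← hQ1]
    exact Finset.sum_le_sum_of_subset_of_nonneg (Finset.subset_univ _) fun y _ _ => hQ0 y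
  have hQsum : ∑ m, ∑ y : Fin n → Y, (∏ i, q (y i)) * (1 + if y ∈ D m then (M : ℝ) else 0) ≤
      2 * M := by
    simp only [mul_add, mul_one, mul_ite, mul_zero, Finset.sum_add_distrib, hQ1,
      Finset.sum_ite_mem, Finset.univ_inter, ← Finset.sum_mul]
    simp only [Finset.sum_const, Finset.card_univ, Fintype.card_fin, nsmul_eq_mul]
    nlinarith
  have htot := Finset.sum_le_sum fun m (_ : m ∈ Finset.univ) =>
    Finset.sum_le_sum fun y (_ : y ∈ Finset.univ) => hpt m y
  simp only [Finset.sum_sub_distrib, Finset.sum_add_distrib, ← Finset.sum_div, hinfo,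
    ← Finset.sum_mul, hv1] at htot
  have hsum := Finset.sum_le_sum fun m (_ : m ∈ Finset.univ) => hsucc m
  simp only [Finset.sum_const, Finset.card_univ, Fintype.card_fin, nsmul_eq_mul] at htot hsum
  refine le_of_mul_le_mul_left ?_ hM0
  nlinarith

end Converse

section Feinstein

/-- Feinstein's maximal code construction for a finite family of channels `V k`, `k ∈ F`. -/
theorem exists_code_of_acceptance {α β ι : Type*} [Fintype β] [DecidableEq β]
    (F : Finset ι) (hF : F.Nonempty) (V : ι → α → β → ℝ) (hV0 : ∀ k x y, 0 ≤ V k x y)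
    (hV1 : ∀ k x, ∑ y, V k x y = 1) (p : α → ℝ) (hp : ∀ x, 0 ≤ p x) (A : Finset α)
    (U : α → Finset β) {ε τ : ℝ} (hε1 : ε < 1)
    (hU : ∀ x ∈ A, ∀ k ∈ F, ∑ y ∈ (U x)ᶜ, V k x y ≤ ε / 2)
    (hτ : ∀ x ∈ A, ∑ y ∈ U x, ∑ k ∈ F, ∑ x' ∈ A, p x' * V k x' y ≤ τ) :
    ∃ (M : ℕ) (c : Fin M → α) (D : Fin M → Finset β), (∀ m, c m ∈ A) ∧
      (∀ m m', m ≠ m' → Disjoint (D m) (D m')) ∧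
      (∀ m, ∀ k ∈ F, ∑ y ∈ (D m)ᶜ, V k (c m) y ≤ ε) ∧
      (∑ x ∈ A, p x) * (ε / 2) ≤ M * τ := by
  let S (M : ℕ) : Prop := ∃ (c : Fin M → α) (D : Fin M → Finset β), (∀ m, c m ∈ A) ∧
    (∀ m m', m ≠ m' → Disjoint (D m) (D m')) ∧
    (∀ m, ∀ k ∈ F, ∑ y ∈ (D m)ᶜ, V k (c m) y ≤ ε) ∧ ∀ m, D m ⊆ U (c m)
  have hbound {M : ℕ} (h : S M) : M ≤ Fintype.card β := by
    obtain ⟨c, D, -, hD, hE, -⟩ := h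
    have hne (m : Fin M) : (D m).Nonempty := by
      rw [Finset.nonempty_iff_ne_empty]
      intro h0
      obtain ⟨k, hk⟩ := hF
      have := hE m k hk
      rw [h0, Finset.compl_empty, hV1] at this
      linarith
    choose f hf using hne
    have hinj : Function.Injective f := fun m m' h => by
      by_contra hmm
      exact Finset.disjoint_left.1 (hD m m' hmm) (hf m) (h ▸ hf m')
    simpa using Fintype.card_le_of_injective f hinj
  obtain ⟨M, ⟨c, D, hcA, hD, hE, hDU⟩, hmax⟩ : ∃ M, S M ∧ ¬ S (M + 1) := by
    by_contra! h
    have hall (M : ℕ) : S M := by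
      induction M with
      | zero => exact ⟨Fin.elim0, Fin.elim0, fun m => m.elim0, fun m => m.elim0,
          fun m => m.elim0, fun m => m.elim0⟩
      | succ M ih => exact h M ih
    exact absurd (hbound (hall (Fintype.card β + 1))) (by omega)
  refine ⟨M, c, D, hcA, hD, hE, ?_⟩
  set B : Finset β := Finset.univ.biUnion D with hB
  have hfail : ∀ x ∈ A, ε / 2 ≤ ∑ k ∈ F, ∑ y ∈ B, V k x y := by
    intro x hx
    by_contra! hlt
    refine hmax ⟨Fin.cons x c, Fin.cons (U x \ B) D, ?_, ?_, ?_, ?_⟩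
    · exact Fin.cases hx hcA
    · have hdis (m : Fin M) : Disjoint (U x \ B) (D m) :=
        Finset.sdiff_disjoint.mono_right (Finset.subset_biUnion_of_mem D (Finset.mem_univ m))
      refine Fin.cases (Fin.cases (fun h => absurd rfl h) fun m _ => hdis m) fun m =>
        Fin.cases (fun _ => (hdis m).symm) fun m' h => hD m m' fun h' => h (h' ▸ rfl)
    · refine Fin.cases (fun k hk => ?_) hE
      have h1 : ∑ y ∈ B, V k x y ≤ ∑ k ∈ F, ∑ y ∈ B, V k x y :=
        Finset.single_le_sum (f := fun k => ∑ y ∈ B, V k x y)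
          (fun k _ => Finset.sum_nonneg fun y _ => hV0 k x y) hk
      have h2 : ∑ y ∈ (U x \ B)ᶜ, V k x y ≤ ∑ y ∈ (U x)ᶜ, V k x y + ∑ y ∈ B, V k x y := by
        rw [← Finset.sum_union_inter]
        refine le_add_of_le_of_nonneg (Finset.sum_le_sum_of_subset_of_nonneg ?_ fun y _ _ =>
          hV0 k x y) (Finset.sum_nonneg fun y _ => hV0 k x y)
        intro y
        simp only [Finset.mem_compl, Finset.mem_sdiff, Finset.mem_union]
        tauto
      simp only [Fin.cons_zero]
      linarith [hU x hx k hk]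
    · exact Fin.cases Finset.sdiff_subset hDU
  calc (∑ x ∈ A, p x) * (ε / 2) ≤ ∑ x ∈ A, p x * ∑ k ∈ F, ∑ y ∈ B, V k x y := by
        rw [Finset.sum_mul]
        exact Finset.sum_le_sum fun x hx => mul_le_mul_of_nonneg_left (hfail x hx) (hp x)
    _ = ∑ y ∈ B, ∑ k ∈ F, ∑ x ∈ A, p x * V k x y := by
        simp_rw [Finset.mul_sum]
        rw [Finset.sum_comm]
        simp_rw [Finset.sum_comm (s := A) (t := B)]
        rw [Finset.sum_comm]
    _ = ∑ m, ∑ y ∈ D m, ∑ k ∈ F, ∑ x ∈ A, p x * V k x y :=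
        Finset.sum_biUnion fun m _ m' _ h => hD m m' h
    _ ≤ ∑ m, τ := by
        refine Finset.sum_le_sum fun m _ => (Finset.sum_le_sum_of_subset_of_nonneg (hDU m)
          fun y _ _ => Finset.sum_nonneg fun k _ => Finset.sum_nonneg fun x _ =>
            mul_nonneg (hp x) (hV0 k x y)).trans (hτ _ (hcA m))
    _ = M * τ := by simp

end Feinstein

theorem sum_prod_mul_prod {X Y : Type} [Fintype X] (P : X → ℝ) (V : X → Y → ℝ) {n : ℕ}
    (y : Fin n → Y) :
    ∑ x : Fin n → X, (∏ i, P (x i)) * ∏ i, V (x i) (y i) = ∏ i, outLaw P V (y i) := by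
  simp_rw [← Finset.prod_mul_distrib]
  exact sum_prod_apply fun i a => P a * V a (y i)

theorem IsChannel.sum_prod {X Y : Type} [Fintype Y] {V : X → Y → ℝ} (hV : IsChannel V) {n : ℕ}
    (x : Fin n → X) : ∑ y : Fin n → Y, ∏ i, V (x i) (y i) = 1 := by
  rw [sum_prod_apply fun i => V (x i)]
  simp [hV.2]

section DirectPart

variable {Θ X Y : Type} [Fintype X] [Fintype Y] {P : X → ℝ}

/-- Chernoff bound for the lower tail of the information density. -/
theorem sum_infoDensity_tail_le (hP : IsPM P) {V : X → Y → ℝ} (hV : IsChannel V) {s : ℝ}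
    (hs : 0 ≤ s) (hs' : s ≤ 1 / 2) (n : ℕ) (ρ : ℝ) :
    ∑ x : Fin n → X, ∑ y : Fin n → Y,
        (if ∏ i, V (x i) (y i) ≤ Real.exp (n * ρ) * ∏ i, outLaw P V (y i) then
          (∏ i, P (x i)) * ∏ i, V (x i) (y i) else 0) ≤
      Real.exp (-(n * (s * (mutInfo P V - ρ) -
        16 * (Fintype.card X * Fintype.card Y) * s ^ 2))) := by
  have hfac (a : X) (b : Y) : 0 ≤ P a * V a b * (outLaw P V b / V a b) ^ s :=
    mul_nonneg (mul_nonneg (hP.1 a) (hV.1 a b))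
      (Real.rpow_nonneg (div_nonneg (outLaw_nonneg hP hV b) (hV.1 a b)) s)
  have hpt (x : Fin n → X) (y : Fin n → Y) :
      (if ∏ i, V (x i) (y i) ≤ Real.exp (n * ρ) * ∏ i, outLaw P V (y i) then
          (∏ i, P (x i)) * ∏ i, V (x i) (y i) else 0) ≤
        Real.exp (n * ρ) ^ s *
          ∏ i, P (x i) * V (x i) (y i) * (outLaw P V (y i) / V (x i) (y i)) ^ s := by
    have hrhs : 0 ≤ Real.exp (n * ρ) ^ s *
        ∏ i, P (x i) * V (x i) (y i) * (outLaw P V (y i) / V (x i) (y i)) ^ s :=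
      mul_nonneg (by positivity) (Finset.prod_nonneg fun i _ => hfac _ _)
    split_ifs with h
    swap
    · exact hrhs
    have hp0 : 0 ≤ ∏ i, P (x i) := Finset.prod_nonneg fun i _ => hP.1 _
    have hv0 : 0 ≤ ∏ i, V (x i) (y i) := Finset.prod_nonneg fun i _ => hV.1 _ _
    rcases hv0.eq_or_lt with hv | hv
    · simpa [← hv] using hrhs
    rw [Finset.prod_mul_distrib, Finset.prod_mul_distrib,
      Real.finsetProd_rpow _ _ fun i _ => div_nonneg (outLaw_nonneg hP hV _) (hV.1 _ _),
      Finset.prod_div_distrib]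
    have h1 : 1 ≤ (Real.exp (n * ρ) *
        ((∏ i, outLaw P V (y i)) / ∏ i, V (x i) (y i))) ^ s := by
      refine Real.one_le_rpow ?_ hs
      rwa [← mul_div_assoc, one_le_div hv]
    rw [Real.mul_rpow (by positivity) (div_nonneg
      (Finset.prod_nonneg fun i _ => outLaw_nonneg hP hV _) hv0)] at h1
    nlinarith [mul_le_mul_of_nonneg_left h1 (mul_nonneg hp0 hv0)]
  calc _ ≤ ∑ x : Fin n → X, ∑ y : Fin n → Y, Real.exp (n * ρ) ^ s *
          ∏ i, P (x i) * V (x i) (y i) * (outLaw P V (y i) / V (x i) (y i)) ^ s :=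
        Finset.sum_le_sum fun x _ => Finset.sum_le_sum fun y _ => hpt x y
    _ = Real.exp (n * ρ) ^ s *
          (∑ a, ∑ b, P a * V a b * (outLaw P V b / V a b) ^ s) ^ n := by
        simp_rw [← Finset.mul_sum]
        rw [sum_sum_prod_apply fun a b => P a * V a b * (outLaw P V b / V a b) ^ s]
    _ ≤ Real.exp (n * ρ) ^ s * Real.exp (-(s * mutInfo P V -
          16 * (Fintype.card X * Fintype.card Y) * s ^ 2)) ^ n := by
        gcongr
        · exact Finset.sum_nonneg fun a _ => Finset.sum_nonneg fun b _ => hfac a b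
        · exact sum_mul_rpow_le_exp hP hV hs hs'
    _ = _ := by
        rw [← Real.exp_mul, ← Real.exp_nat_mul, ← Real.exp_add]
        congr 1
        ring

/-- A code for a finite compound channel whose codewords are taken from `G`. -/
theorem exists_code_of_finset [DecidableEq Y] (hP : IsPM P) (W : Θ → X → Y → ℝ)
    (hW : ∀ θ, IsChannel (W θ)) (F : Finset Θ) (hF : F.Nonempty) {r : ℝ}
    (hr : ∀ θ ∈ F, r ≤ mutInfo P (W θ)) (n : ℕ) (G : Finset (Fin n → X)) {ε δ s : ℝ}
    (hε0 : 0 < ε) (hε1 : ε < 1) (hs : 0 ≤ s) (hs' : s ≤ 1 / 2) :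
    ∃ (M : ℕ) (c : Fin M → Fin n → X) (D : Fin M → Finset (Fin n → Y)), (∀ m, c m ∈ G) ∧
      (∀ m m', m ≠ m' → Disjoint (D m) (D m')) ∧
      (∀ m, ∀ θ ∈ F, Wn W n θ (c m) (D m)ᶜ ≤ ε) ∧
      (∑ x ∈ G, ∏ i, P (x i) - 2 / ε * (F.card * (Real.exp (-(n * (s * δ -
        16 * (Fintype.card X * Fintype.card Y) * s ^ 2))) + F.card * Real.exp (-(n * δ))))) *
          (ε / 2) ≤ M * (F.card * Real.exp (-(n * (r - 2 * δ)))) := by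
  classical
  set p : (Fin n → X) → ℝ := fun x => ∏ i, P (x i) with hp
  set V : Θ → (Fin n → X) → (Fin n → Y) → ℝ := fun θ x y => ∏ i, W θ (x i) (y i) with hV
  set q : Θ → (Fin n → Y) → ℝ := fun θ y => ∏ i, outLaw P (W θ) (y i) with hq
  set Q : (Fin n → Y) → ℝ := fun y => ∑ θ ∈ F, q θ y with hQ
  set t : ℝ := Real.exp (n * (r - 2 * δ)) with ht
  have ht0 : 0 < t := Real.exp_pos _
  have hp0 (x) : 0 ≤ p x := Finset.prod_nonneg fun i _ => hP.1 _
  have hV0 (θ x y) : 0 ≤ V θ x y := Finset.prod_nonneg fun i _ => (hW θ).1 _ _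
  have hV1 (θ x) : ∑ y, V θ x y = 1 := (hW θ).sum_prod x
  have hq0 (θ y) : 0 ≤ q θ y := Finset.prod_nonneg fun i _ => outLaw_nonneg hP (hW θ) _
  have hQ0 (y) : 0 ≤ Q y := Finset.sum_nonneg fun θ _ => hq0 θ y
  have hpV (θ y) : ∑ x, p x * V θ x y = q θ y := sum_prod_mul_prod P (W θ) y
  have hq1 (θ) : ∑ y, q θ y = 1 := by
    simp [hq, sum_prod_apply fun _ : Fin n => outLaw P (W θ), sum_outLaw hP (hW θ)]
  have hQ1 : ∑ y, Q y = F.card := by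
    simp only [hQ]
    rw [Finset.sum_comm]
    simp [hq1]
  set T : Θ → (Fin n → X) → Finset (Fin n → Y) :=
    fun θ x => Finset.univ.filter fun y => t * Q y < V θ x y with hT
  set A : Finset (Fin n → X) := G.filter fun x => ∀ θ ∈ F, ∑ y ∈ (T θ x)ᶜ, V θ x y ≤ ε / 2 with hA
  have hmiss (θ : Θ) (hθ : θ ∈ F) : ∑ x, p x * ∑ y ∈ (T θ x)ᶜ, V θ x y ≤
      Real.exp (-(n * (s * δ - 16 * (Fintype.card X * Fintype.card Y) * s ^ 2))) +
        F.card * Real.exp (-(n * δ)) := by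
    have hpt (x y) : (if y ∈ (T θ x)ᶜ then p x * V θ x y else 0) ≤
        (if V θ x y ≤ Real.exp (n * (r - δ)) * q θ y then p x * V θ x y else 0) +
          (if Real.exp (n * (r - δ)) * q θ y ≤ t * Q y then p x * V θ x y else 0) := by
      have h0 := mul_nonneg (hp0 x) (hV0 θ x y)
      simp only [hT, Finset.mem_compl, Finset.mem_filter, Finset.mem_univ, true_and, not_lt]
      split_ifs <;> linarith
    have hsecond : ∑ x, ∑ y, (if Real.exp (n * (r - δ)) * q θ y ≤ t * Q y then
        p x * V θ x y else 0) ≤ F.card * Real.exp (-(n * δ)) := by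
      rw [Finset.sum_comm, ← hQ1, Finset.sum_mul]
      refine Finset.sum_le_sum fun y _ => ?_
      split_ifs with h
      · rw [hpV]
        have h1 : t = Real.exp (n * (r - δ)) * Real.exp (-(n * δ)) := by
          rw [ht, ← Real.exp_add]
          congr 1
          ring
        rw [h1, mul_assoc] at h
        linarith [le_of_mul_le_mul_left h (Real.exp_pos _)]
      · simpa using mul_nonneg (hQ0 y) (Real.exp_pos _).le
    have hfirst := sum_infoDensity_tail_le hP (hW θ) hs hs' n (r - δ)
    have hmono : Real.exp (-(n * (s * (mutInfo P (W θ) - (r - δ)) -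
        16 * (Fintype.card X * Fintype.card Y) * s ^ 2))) ≤
        Real.exp (-(n * (s * δ - 16 * (Fintype.card X * Fintype.card Y) * s ^ 2))) := by
      have := hr θ hθ
      gcongr
      linarith
    calc _ = ∑ x, ∑ y, (if y ∈ (T θ x)ᶜ then p x * V θ x y else 0) := by
          simp only [Finset.mul_sum, Finset.sum_ite_mem, Finset.univ_inter]
      _ ≤ _ := Finset.sum_le_sum fun x _ => Finset.sum_le_sum fun y _ => hpt x y
      _ ≤ _ := by
          simp_rw [Finset.sum_add_distrib]
          exact add_le_add (hfirst.trans hmono) hsecond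
  have hAG : ∑ x ∈ G, p x - 2 / ε * (F.card * (Real.exp (-(n * (s * δ -
      16 * (Fintype.card X * Fintype.card Y) * s ^ 2))) + F.card * Real.exp (-(n * δ)))) ≤
      ∑ x ∈ A, p x := by
    have hbad : ∑ x ∈ G.filter (fun x => ¬ ∀ θ ∈ F, ∑ y ∈ (T θ x)ᶜ, V θ x y ≤ ε / 2), p x ≤
        2 / ε * ∑ θ ∈ F, ∑ x, p x * ∑ y ∈ (T θ x)ᶜ, V θ x y := by
      rw [Finset.sum_comm, Finset.mul_sum]
      refine (Finset.sum_le_sum fun x hx => ?_).trans (Finset.sum_le_sum_of_subset_of_nonneg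
        (Finset.subset_univ _) fun x _ _ => ?_)
      · have hx' := (Finset.mem_filter.1 hx).2
        push Not at hx'
        obtain ⟨θ, hθ, hlt⟩ := hx'
        rw [← Finset.mul_sum]
        have h1 : ε / 2 ≤ ∑ θ ∈ F, ∑ y ∈ (T θ x)ᶜ, V θ x y :=
          hlt.le.trans (Finset.single_le_sum (f := fun θ => ∑ y ∈ (T θ x)ᶜ, V θ x y)
            (fun θ _ => Finset.sum_nonneg fun y _ => hV0 θ x y) hθ)
        calc p x = 2 / ε * (p x * (ε / 2)) := by field_simp
          _ ≤ _ := by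
            have := hp0 x
            gcongr
      · exact mul_nonneg (by positivity) (Finset.sum_nonneg fun θ _ => mul_nonneg (hp0 x)
          (Finset.sum_nonneg fun y _ => hV0 θ x y))
    have hsplit := Finset.sum_filter_add_sum_filter_not G
      (fun x => ∀ θ ∈ F, ∑ y ∈ (T θ x)ᶜ, V θ x y ≤ ε / 2) p
    have hle := Finset.sum_le_sum hmiss
    rw [Finset.sum_const, nsmul_eq_mul] at hle
    have := mul_le_mul_of_nonneg_left hle (show 0 ≤ 2 / ε by positivity)
    linarith
  set U : (Fin n → X) → Finset (Fin n → Y) := fun x => F.biUnion fun θ => T θ x with hU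
  have hUA : ∀ x ∈ A, ∀ θ ∈ F, ∑ y ∈ (U x)ᶜ, V θ x y ≤ ε / 2 := by
    intro x hx θ hθ
    refine le_trans (Finset.sum_le_sum_of_subset_of_nonneg (Finset.compl_subset_compl.2 ?_)
      fun y _ _ => hV0 θ x y) ((Finset.mem_filter.1 hx).2 θ hθ)
    exact Finset.subset_biUnion_of_mem (fun θ => T θ x) hθ
  have hUQ : ∀ x ∈ A, ∑ y ∈ U x, ∑ θ ∈ F, ∑ x' ∈ A, p x' * V θ x' y ≤
      F.card * Real.exp (-(n * (r - 2 * δ))) := by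
    intro x _
    calc _ ≤ ∑ y ∈ U x, t⁻¹ * ∑ θ ∈ F, V θ x y := by
          refine Finset.sum_le_sum fun y hy => ?_
          obtain ⟨θ, hθ, hy⟩ := Finset.mem_biUnion.1 hy
          calc _ ≤ Q y := by
                refine Finset.sum_le_sum fun θ _ => ?_
                rw [← hpV]
                exact Finset.sum_le_sum_of_subset_of_nonneg (Finset.subset_univ _) fun x _ _ =>
                  mul_nonneg (hp0 x) (hV0 θ x y)
            _ ≤ t⁻¹ * V θ x y := by
                rw [inv_mul_eq_div, le_div_iff₀ ht0, mul_comm]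
                exact (Finset.mem_filter.1 hy).2.le
            _ ≤ _ := by
                gcongr
                exact Finset.single_le_sum (f := fun θ => V θ x y) (fun θ _ => hV0 θ x y) hθ
      _ ≤ t⁻¹ * ∑ y, ∑ θ ∈ F, V θ x y := by
          rw [← Finset.mul_sum]
          gcongr
          · exact fun y _ _ => Finset.sum_nonneg fun θ _ => hV0 θ x y
          · exact Finset.subset_univ _
      _ = _ := by
          rw [Finset.sum_comm]
          simp only [hV1, Finset.sum_const, nsmul_eq_mul, mul_one]
          rw [ht, ← Real.exp_neg, mul_comm]
  obtain ⟨M, c, D, hc, hD, hE, hM⟩ :=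
    exists_code_of_acceptance F hF V hV0 hV1 p hp0 A U hε1 hUA hUQ
  refine ⟨M, c, D, fun m => (Finset.mem_filter.1 (hc m)).1, hD, hE, le_trans ?_ hM⟩
  gcongr

/-- A family of channels between finite alphabets contains an `L⁻¹`-net of size polynomial
in `L`. -/
theorem exists_finset_net (W : Θ → X → Y → ℝ)
    (hW : ∀ θ, IsChannel (W θ)) (Λ : Set Θ) {L : ℕ} (hL : 0 < L) :
    ∃ F : Finset Θ, ↑F ⊆ Λ ∧ (∀ θ ∈ Λ, ∃ θ' ∈ F, ∀ a b, |W θ a b - W θ' a b| ≤ (L : ℝ)⁻¹) ∧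
      F.card ≤ (L + 1) ^ (Fintype.card X * Fintype.card Y) := by
  classical
  have hlt (θ : Θ) (z : X × Y) : ⌊(L : ℝ) * W θ z.1 z.2⌋₊ < L + 1 := by
    have h := Nat.floor_le_floor (mul_le_of_le_one_right (Nat.cast_nonneg (α := ℝ) L)
      ((hW θ).le_one z.1 z.2))
    rw [Nat.floor_natCast] at h
    omega
  set φ : Θ → X × Y → Fin (L + 1) := fun θ z => ⟨⌊(L : ℝ) * W θ z.1 z.2⌋₊, hlt θ z⟩ with hφ
  obtain ⟨S, hS, hbij⟩ := Set.exists_subset_bijOn Λ φ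
  have hfin : S.Finite := Set.Finite.of_finite_image (Set.toFinite _) hbij.injOn
  refine ⟨hfin.toFinset, by simpa using hS, fun θ hθ => ?_, ?_⟩
  · obtain ⟨θ', hθ', heq⟩ := hbij.surjOn (Set.mem_image_of_mem φ hθ)
    refine ⟨θ', by simpa using hθ', fun a b => ?_⟩
    have h := congrArg Fin.val (congrFun heq (a, b))
    simp only [hφ] at h
    have hL' : (0 : ℝ) < L := by exact_mod_cast hL
    have h1 := Nat.floor_le (mul_nonneg hL'.le ((hW θ).1 a b))
    have h2 := Nat.lt_floor_add_one ((L : ℝ) * W θ a b)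
    have h3 := Nat.floor_le (mul_nonneg hL'.le ((hW θ').1 a b))
    have h4 := Nat.lt_floor_add_one ((L : ℝ) * W θ' a b)
    rw [h] at h3 h4
    have h5 : (L : ℝ) * |W θ a b - W θ' a b| ≤ 1 := by
      rw [← abs_of_pos hL', ← abs_mul, mul_sub, abs_le]
      constructor <;> linarith
    rwa [← one_div, le_div_iff₀' hL']
  · have := Finset.card_le_card_of_injOn φ (s := hfin.toFinset) (t := Finset.univ) (by simp)
      (by simpa using hbij.injOn)
    simpa using this

theorem Wn_le_add_of_abs_sub_le {Θ X Y : Type} [Fintype Y] (W : Θ → X → Y → ℝ)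
    (hW : ∀ θ, IsChannel (W θ)) {θ θ' : Θ} {κ : ℝ} (h : ∀ a b, |W θ a b - W θ' a b| ≤ κ)
    (n : ℕ) (x : Fin n → X) (B : Finset (Fin n → Y)) :
    Wn W n θ x B ≤ Wn W n θ' x B + n * (Fintype.card Y * κ) := by
  have h1 := sum_abs_prod_sub_prod_le (fun i => W θ (x i)) (fun i => W θ' (x i))
    (fun i => (hW θ).1 _) (fun i => (hW θ').1 _) (fun i => (hW θ).2 _) (fun i => (hW θ').2 _)
  have h2 : ∑ i : Fin n, ∑ b, |W θ (x i) b - W θ' (x i) b| ≤ n * (Fintype.card Y * κ) := by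
    calc _ ≤ ∑ i : Fin n, ∑ b : Y, κ :=
          Finset.sum_le_sum fun i _ => Finset.sum_le_sum fun b _ => h _ _
      _ = _ := by simp
  have h3 : ∑ y ∈ B, (∏ i, W θ (x i) (y i) - ∏ i, W θ' (x i) (y i)) ≤
      ∑ y : Fin n → Y, |∏ i, W θ (x i) (y i) - ∏ i, W θ' (x i) (y i)| :=
    (Finset.sum_le_sum fun y _ => le_abs_self (∏ i, W θ (x i) (y i) - ∏ i, W θ' (x i) (y i))).trans
      (Finset.sum_le_sum_of_subset_of_nonneg (Finset.subset_univ B) fun y _ _ => abs_nonneg _)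
  rw [Finset.sum_sub_distrib] at h3
  unfold Wn
  linarith

theorem exists_sum_tail_le_exp (hP : IsPM P) {g : X → ℝ} (hg : ∑ a, P a * g a < 0) :
    ∃ c : ℝ, 0 < c ∧ ∀ n : ℕ, ∑ x : Fin n → X with 0 < ∑ i, g (x i), ∏ i, P (x i) ≤
      Real.exp (-(c * n)) := by
  set m := ∑ a, P a * g a with hm
  set C := ∑ a, P a * (g a ^ 2 * max 1 (Real.exp (g a))) with hC
  have hC0 : 0 ≤ C := Finset.sum_nonneg fun a _ => mul_nonneg (hP.1 a) (by positivity)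
  set s := min 1 (-m / (2 * (C + 1))) with hs
  have hs0 : 0 < s := lt_min one_pos (div_pos (neg_pos.2 hg) (by positivity))
  have hsm : s * C ≤ -m / 2 := by
    have h1 : s * (2 * (C + 1)) ≤ -m := by
      rw [← le_div_iff₀ (by positivity)]
      exact min_le_right _ _
    nlinarith
  have hmgf : ∑ a, P a * Real.exp (s * g a) ≤ Real.exp (s * m / 2) := by
    have hpt (a : X) : P a * Real.exp (s * g a) ≤
        P a + s * (P a * g a) + s ^ 2 * (P a * (g a ^ 2 * max 1 (Real.exp (g a)))) := by
      have h1 := exp_le_one_add_add_sq_mul (u := s * g a)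
      have h2 : max 1 (Real.exp (s * g a)) ≤ max 1 (Real.exp (g a)) := by
        rcases le_total (g a) 0 with h | h
        · exact max_le (le_max_left _ _) (le_max_of_le_left
            (Real.exp_le_one_iff.2 (mul_nonpos_of_nonneg_of_nonpos hs0.le h)))
        · exact max_le_max le_rfl (Real.exp_le_exp.2
            (mul_le_of_le_one_left h (min_le_left _ _)))
      have h3 := mul_le_mul_of_nonneg_left h2 (sq_nonneg (s * g a))
      have h4 := mul_le_mul_of_nonneg_left (h1.trans (add_le_add_right h3 _)) (hP.1 a)
      linarith
    calc _ ≤ _ := Finset.sum_le_sum fun a _ => hpt a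
      _ = 1 + s * m + s ^ 2 * C := by
          rw [Finset.sum_add_distrib, Finset.sum_add_distrib, hP.2, ← Finset.mul_sum,
            ← Finset.mul_sum]
      _ ≤ s * m / 2 + 1 := by nlinarith
      _ ≤ _ := Real.add_one_le_exp _
  refine ⟨-(s * m / 2), by nlinarith, fun n => ?_⟩
  calc _ ≤ ∑ x : Fin n → X with 0 < ∑ i, g (x i), ∏ i, P (x i) * Real.exp (s * g (x i)) := by
        refine Finset.sum_le_sum fun x hx => ?_
        rw [Finset.prod_mul_distrib, ← Real.exp_sum, ← Finset.mul_sum]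
        refine le_mul_of_one_le_right (Finset.prod_nonneg fun i _ => hP.1 _)
          (Real.one_le_exp ?_)
        exact mul_nonneg hs0.le (Finset.mem_filter.1 hx).2.le
    _ ≤ ∑ x : Fin n → X, ∏ i, P (x i) * Real.exp (s * g (x i)) :=
        Finset.sum_le_sum_of_subset_of_nonneg (Finset.subset_univ _) fun x _ _ =>
          Finset.prod_nonneg fun i _ => mul_nonneg (hP.1 _) (Real.exp_pos _).le
    _ = (∑ a, P a * Real.exp (s * g a)) ^ n := by
        rw [sum_prod_apply fun _ a => P a * Real.exp (s * g a)]
        simp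
    _ ≤ Real.exp (s * m / 2) ^ n := by
        gcongr
        exact Finset.sum_nonneg fun a _ => mul_nonneg (hP.1 _) (Real.exp_pos _).le
    _ = _ := by
        rw [← Real.exp_nat_mul]
        congr 1
        ring

theorem eventually_half_le_sum_cost (hP : IsPM P) {Γ : X → ℝ} {B : ℝ}
    (h : ∑ a, Γ a * P a < B ∨ ∀ a, P a ≠ 0 → Γ a ≤ B) :
    ∀ᶠ n : ℕ in Filter.atTop,
      1 / 2 ≤ ∑ x : Fin n → X with ∑ i, Γ (x i) ≤ n * B, ∏ i, P (x i) := by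
  have hsplit (n : ℕ) : (∑ x : Fin n → X with ∑ i, Γ (x i) ≤ n * B, ∏ i, P (x i)) +
      ∑ x : Fin n → X with ¬ ∑ i, Γ (x i) ≤ n * B, ∏ i, P (x i) = 1 := by
    rw [Finset.sum_filter_add_sum_filter_not, sum_prod_apply fun _ => P]
    simp [hP.2]
  have hset (n : ℕ) (x : Fin n → X) : ¬ ∑ i, Γ (x i) ≤ n * B ↔ 0 < ∑ i, (Γ (x i) - B) := by
    simp
  rcases h with h | h
  · obtain ⟨c, hc, hle⟩ := exists_sum_tail_le_exp hP (g := fun a => Γ a - B) (by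
      simp_rw [mul_sub, Finset.sum_sub_distrib, ← Finset.sum_mul, hP.2, mul_comm (P _)]
      linarith)
    have hlim : Filter.Tendsto (fun n : ℕ => Real.exp (-(c * n))) Filter.atTop (nhds 0) :=
      Real.tendsto_exp_neg_atTop_nhds_zero.comp
        (tendsto_natCast_atTop_atTop.const_mul_atTop hc)
    filter_upwards [hlim.eventually_le_const (show (0 : ℝ) < 1 / 2 by norm_num)] with n hn
    have h1 := hsplit n
    simp_rw [hset] at h1
    have := hle n
    linarith
  · refine Filter.Eventually.of_forall fun n => ?_
    have h0 : ∑ x : Fin n → X with ¬ ∑ i, Γ (x i) ≤ n * B, ∏ i, P (x i) = 0 := by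
      refine Finset.sum_eq_zero fun x hx => ?_
      by_contra hne
      refine (Finset.mem_filter.1 hx).2 ?_
      calc ∑ i, Γ (x i) ≤ ∑ _i : Fin n, B :=
            Finset.sum_le_sum fun i hi => h _ (Finset.prod_ne_zero_iff.1 hne i hi)
        _ = n * B := by simp
    linarith [hsplit n]

theorem eventually_mul_pow_le_exp (A : ℝ) (D : ℕ) {c : ℝ} (hc : 0 < c) :
    ∀ᶠ n : ℕ in Filter.atTop, A * ((n : ℝ) ^ 2 + 1) ^ D ≤ Real.exp (n * c) := by
  have h := (isLittleO_pow_exp_pos_mul_atTop (2 * D) hc).comp_tendsto tendsto_natCast_atTop_atTop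
  have hpos : 0 < (|A| * 2 ^ D + 1)⁻¹ := by positivity
  filter_upwards [h.bound hpos, Filter.eventually_ge_atTop 1] with n hn hn1
  simp only [Function.comp_apply, Real.norm_eq_abs, Real.abs_exp] at hn
  rw [abs_of_nonneg (by positivity), inv_mul_eq_div, le_div_iff₀ (by positivity)] at hn
  have hn1' : (1 : ℝ) ≤ n := by exact_mod_cast hn1
  calc A * ((n : ℝ) ^ 2 + 1) ^ D ≤ |A| * (2 * (n : ℝ) ^ 2) ^ D := by
        gcongr
        · exact le_abs_self A
        · nlinarith
    _ = (n : ℝ) ^ (2 * D) * (|A| * 2 ^ D) := by rw [mul_pow, ← pow_mul]; ring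
    _ ≤ (n : ℝ) ^ (2 * D) * (|A| * 2 ^ D + 1) := by gcongr; linarith
    _ ≤ _ := by rwa [mul_comm (n : ℝ) c]

theorem achievable_of_le_mutInfo [DecidableEq X] [DecidableEq Y] [MeasurableSpace Θ]
    (μ : MeasureTheory.Measure Θ) (W : Θ → X → Y → ℝ) (hW : ∀ θ, IsChannel (W θ)) (hP : IsPM P)
    {Γ : X → ℝ} {B : ℝ} (hcost : ∑ a, Γ a * P a < B ∨ ∀ a, P a ≠ 0 → Γ a ≤ B) {γ : ℝ} {Λ : Set Θ}
    (hΛ : Λ.Nonempty) (hμ : ENNReal.ofReal (1 - γ) ≤ μ Λ) {r : ℝ}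
    (hr : ∀ θ ∈ Λ, r ≤ mutInfo P (W θ)) {ε : ℝ} (hε0 : 0 < ε) (hε1 : ε < 1) :
    Achievable μ W Γ B γ ε r := by
  intro δ hδ
  set d := δ / 4 with hd
  have hd0 : 0 < d := by positivity
  set C : ℝ := 16 * (Fintype.card X * Fintype.card Y) with hC
  have hC0 : 0 ≤ C := by positivity
  set s : ℝ := min (1 / 2) (d / (2 * (C + 1))) with hs
  have hs0 : 0 < s := lt_min (by norm_num) (by positivity)
  have hη : 0 < s * d - C * s ^ 2 := by
    have h1 : s * (2 * (C + 1)) ≤ d := by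
      rw [← le_div_iff₀ (by positivity)]
      exact min_le_right _ _
    nlinarith
  set e : ℝ := min (s * d - C * s ^ 2) d with he
  have he0 : 0 < e := lt_min hη hd0
  set K : ℕ := Fintype.card X * Fintype.card Y with hK
  have hlim : ∀ᶠ n : ℕ in Filter.atTop, (n : ℝ)⁻¹ * Fintype.card Y ≤ ε / 2 := by
    have h := (tendsto_inv_atTop_nhds_zero_nat (𝕜 := ℝ)).mul_const (Fintype.card Y : ℝ)
    rw [zero_mul] at h
    exact h.eventually_le_const (by positivity)
  obtain ⟨N, hN⟩ := Filter.eventually_atTop.1 (hlim.and <|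
    (eventually_half_le_sum_cost hP hcost).and <|
    (eventually_mul_pow_le_exp (32 / ε) (K * 2) he0).and <|
    (eventually_mul_pow_le_exp (16 / ε) K (show 0 < 2 * d by positivity)).and
    (Filter.eventually_ge_atTop 1))
  refine ⟨N, fun n hn => ?_⟩
  obtain ⟨hn1, hn2, hn3, hn4, hn5⟩ := hN n hn
  have hn0 : (0 : ℝ) < n := by exact_mod_cast hn5
  obtain ⟨F, hFΛ, hnet, hcard⟩ := exists_finset_net W hW Λ (show 0 < n ^ 2 by positivity)
  have hFne : F.Nonempty := by
    obtain ⟨θ, hθ⟩ := hΛ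
    obtain ⟨θ', hθ', -⟩ := hnet θ hθ
    exact ⟨θ', hθ'⟩
  obtain ⟨M, c, D, hcG, hD, herr, hM⟩ := exists_code_of_finset hP W hW F hFne
    (fun θ hθ => hr θ (hFΛ hθ)) n {x : Fin n → X | ∑ i, Γ (x i) ≤ n * B} (δ := d)
    (half_pos hε0) (by linarith) hs0.le (min_le_left _ _)
  set κ : ℝ := ((n : ℝ) ^ 2 + 1) ^ K with hκ
  have hκ1 : 1 ≤ κ := one_le_pow₀ (by nlinarith)
  have hFκ : (F.card : ℝ) ≤ κ := by
    rw [hκ, hK]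
    exact_mod_cast hcard
  have htail : 2 / (ε / 2) * (F.card * (Real.exp (-(n * (s * d - C * s ^ 2))) +
      F.card * Real.exp (-(n * d)))) ≤ 1 / 4 := by
    have h1 : Real.exp (-(n * (s * d - C * s ^ 2))) ≤ κ * Real.exp (-(n * e)) := by
      refine le_trans ?_ (le_mul_of_one_le_left (Real.exp_pos _).le hκ1)
      gcongr
      exact min_le_left _ _
    have h2 : F.card * Real.exp (-(n * d)) ≤ κ * Real.exp (-(n * e)) := by
      gcongr
      exact min_le_right _ _
    calc _ ≤ 2 / (ε / 2) * (κ * (κ * Real.exp (-(n * e)) + κ * Real.exp (-(n * e)))) := by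
          gcongr
      _ = (32 / ε * ((n : ℝ) ^ 2 + 1) ^ (K * 2)) * Real.exp (-(n * e)) / 4 := by
          rw [pow_mul, ← hκ]
          field_simp
          ring
      _ ≤ Real.exp (n * e) * Real.exp (-(n * e)) / 4 := by gcongr
      _ = 1 / 4 := by rw [← Real.exp_add]; simp
  have hMlow : 1 ≤ M * Real.exp (-(n * (r - 4 * d))) := by
    have h1 : ε / 16 ≤ M * (κ * Real.exp (-(n * (r - 2 * d)))) := by
      calc ε / 16 = (1 / 2 - 1 / 4) * (ε / 2 / 2) := by ring
        _ ≤ _ := by gcongr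
        _ ≤ _ := hM
        _ ≤ _ := by gcongr
    calc (1 : ℝ) = 16 / ε * (ε / 16) := by field_simp
      _ ≤ 16 / ε * (M * (κ * Real.exp (-(n * (r - 2 * d))))) := by gcongr
      _ = M * ((16 / ε * κ) * Real.exp (-(n * (r - 2 * d)))) := by ring
      _ ≤ M * (Real.exp (n * (2 * d)) * Real.exp (-(n * (r - 2 * d)))) := by gcongr
      _ = _ := by rw [← Real.exp_add]; ring_nf
  have hM0 : 0 < M := by
    rcases Nat.eq_zero_or_pos M with rfl | h
    · norm_num at hMlow
    · exact h
  have hM0' : (0 : ℝ) < M := by exact_mod_cast hM0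
  refine ⟨M, c, D, hM0, fun m => ?_, hD, hμ.trans (MeasureTheory.measure_mono fun θ hθ m => ?_), ?_⟩
  · have h1 := (Finset.mem_filter.1 (hcG m)).2
    rw [← mul_sum_mul_emp hn5] at h1
    exact le_of_mul_le_mul_left h1 hn0
  · obtain ⟨θ', hθ', hclose⟩ := hnet θ hθ
    have h1 := Wn_le_add_of_abs_sub_le W hW hclose n (c m) (D m)ᶜ
    have h2 : (n : ℝ) * (Fintype.card Y * ((n ^ 2 : ℕ) : ℝ)⁻¹) = (n : ℝ)⁻¹ * Fintype.card Y := by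
      push_cast
      field_simp
    linarith [herr m θ' hθ']
  · have h1 := Real.log_nonneg hMlow
    rw [Real.log_mul hM0'.ne' (Real.exp_pos _).ne', Real.log_exp] at h1
    rw [← div_eq_inv_mul, le_div_iff₀ hn0]
    have : d * 4 = δ := by rw [hd]; ring
    nlinarith

theorem achievable_mul_of_le_mutInfo [DecidableEq X] [DecidableEq Y] [MeasurableSpace Θ]
    (μ : MeasureTheory.Measure Θ) (W : Θ → X → Y → ℝ) (hW : ∀ θ, IsChannel (W θ)) (hP : IsPM P)
    {Γ : X → ℝ} {B : ℝ} (hcost : ∑ a, Γ a * P a ≤ B) {a₀ : X} (ha₀ : Γ a₀ ≤ B)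
    (hmin : ∀ a, Γ a₀ ≤ Γ a) {γ : ℝ} {Λ : Set Θ} (hΛ : Λ.Nonempty)
    (hμ : ENNReal.ofReal (1 - γ) ≤ μ Λ) {r : ℝ} (hr : ∀ θ ∈ Λ, r ≤ mutInfo P (W θ)) {t : ℝ}
    (ht0 : 0 < t) (ht1 : t < 1) {ε : ℝ} (hε0 : 0 < ε) (hε1 : ε < 1) :
    Achievable μ W Γ B γ ε (t * r) := by
  set P' : X → ℝ := fun a => t * P a + (1 - t) * (Pi.single a₀ 1 : X → ℝ) a with hP'
  have hsingle (a : X) : 0 ≤ (Pi.single a₀ 1 : X → ℝ) a := by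
    rw [Pi.single_apply]
    split_ifs <;> norm_num
  have hle (a : X) : t * P a ≤ P' a :=
    le_add_of_nonneg_right (mul_nonneg (by linarith) (hsingle a))
  have hPM' : IsPM P' := by
    refine ⟨fun a => (mul_nonneg ht0.le (hP.1 a)).trans (hle a), ?_⟩
    rw [hP', Finset.sum_add_distrib, ← Finset.mul_sum, ← Finset.mul_sum, hP.2,
      Finset.sum_pi_single']
    simp
  refine achievable_of_le_mutInfo μ W hW hPM' ?_ hΛ hμ (fun θ hθ =>
    (mul_le_mul_of_nonneg_left (hr θ hθ) ht0.le).trans (le_mutInfo_mix hP hPM' (hW θ) ht0 hle))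
    hε0 hε1
  rcases ha₀.lt_or_eq with h | h
  · left
    have h1 : ∑ a, Γ a * P' a = t * ∑ a, Γ a * P a + (1 - t) * Γ a₀ := by
      have h2 : ∑ a, Γ a * (Pi.single a₀ 1 : X → ℝ) a = Γ a₀ := by simp [Pi.single_apply]
      rw [← h2, Finset.mul_sum, Finset.mul_sum, ← Finset.sum_add_distrib]
      exact Finset.sum_congr rfl fun a _ => by rw [hP']; ring
    rw [h1]
    nlinarith
  · right
    have h1 : ∑ a, (Γ a - B) * P a ≤ 0 := by
      simp_rw [sub_mul, Finset.sum_sub_distrib, ← Finset.mul_sum, hP.2]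
      linarith
    have h2 (a : X) (_ : a ∈ Finset.univ) : 0 ≤ (Γ a - B) * P a :=
      mul_nonneg (by linarith [hmin a]) (hP.1 a)
    have h3 := (Finset.sum_eq_zero_iff_of_nonneg h2).1 (le_antisymm h1 (Finset.sum_nonneg h2))
    intro a ha
    rcases eq_or_ne a a₀ with rfl | hne
    · exact ha₀
    · have hPa : P a ≠ 0 := by
        rintro h0
        exact ha (by simp [hP', h0, hne])
      have := (mul_eq_zero.1 (h3 a (Finset.mem_univ a))).resolve_right hPa
      linarith

end DirectPart

section RatesFormula

variable {Θ X Y : Type} [Fintype X] [Fintype Y] [MeasurableSpace Θ] {μ : MeasureTheory.Measure Θ}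
  {W : Θ → X → Y → ℝ} {γ : ℝ} {P : X → ℝ}

theorem nonempty_of_ofReal_le (hγ : γ < 1) {Λ : Set Θ} (hμ : ENNReal.ofReal (1 - γ) ≤ μ Λ) :
    Λ.Nonempty := by
  refine MeasureTheory.nonempty_of_measure_ne_zero (μ := μ) fun h => ?_
  rw [h, nonpos_iff_eq_zero, ENNReal.ofReal_eq_zero] at hμ
  linarith

theorem sInf_mutInfo_le {Θ : Type} {W : Θ → X → Y → ℝ} (hW : ∀ θ, IsChannel (W θ))
    (hP : IsPM P) {Λ : Set Θ} {θ : Θ} (hθ : θ ∈ Λ) :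
    sInf ((fun θ => mutInfo P (W θ)) '' Λ) ≤ mutInfo P (W θ) :=
  csInf_le ⟨0, by rintro _ ⟨θ, -, rfl⟩; exact mutInfo_nonneg hP (hW θ)⟩
    (Set.mem_image_of_mem _ hθ)

theorem sInf_mutInfo_le_card (hγ : γ < 1) (hW : ∀ θ, IsChannel (W θ)) (hP : IsPM P) {Λ : Set Θ}
    (hμ : ENNReal.ofReal (1 - γ) ≤ μ Λ) :
    sInf ((fun θ => mutInfo P (W θ)) '' Λ) ≤ Fintype.card X * Fintype.card Y := by
  obtain ⟨θ, hθ⟩ := nonempty_of_ofReal_le hγ hμ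
  exact (sInf_mutInfo_le hW hP hθ).trans (mutInfo_le_card hP (hW θ))

theorem ratesFormula_le_iff [MeasureTheory.IsProbabilityMeasure μ] (hγ0 : 0 ≤ γ) (hγ : γ < 1)
    (hW : ∀ θ, IsChannel (W θ)) (hP : IsPM P) {v : ℝ} :
    ratesFormula μ W γ P ≤ v ↔ ∀ Λ : Set Θ, MeasurableSet Λ → ENNReal.ofReal (1 - γ) ≤ μ Λ →
      sInf ((fun θ => mutInfo P (W θ)) '' Λ) ≤ v := by
  rw [ratesFormula, csSup_le_iff]
  · exact ⟨fun h Λ hm hΛ => h _ ⟨Λ, hm, hΛ, rfl⟩, by rintro h _ ⟨Λ, hm, hΛ, rfl⟩; exact h Λ hm hΛ⟩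
  · refine ⟨Fintype.card X * Fintype.card Y, ?_⟩
    rintro _ ⟨Λ, -, hΛ, rfl⟩
    exact sInf_mutInfo_le_card hγ hW hP hΛ
  · refine ⟨_, Set.univ, MeasurableSet.univ, ?_, rfl⟩
    rw [MeasureTheory.measure_univ]
    exact ENNReal.ofReal_le_one.2 (by linarith)

theorem le_ratesFormula [MeasureTheory.IsProbabilityMeasure μ] (hγ0 : 0 ≤ γ) (hγ : γ < 1)
    (hW : ∀ θ, IsChannel (W θ)) (hP : IsPM P) {Λ : Set Θ} (hΛ : MeasurableSet Λ)
    (hμ : ENNReal.ofReal (1 - γ) ≤ μ Λ) {v : ℝ} (hv : ∀ θ ∈ Λ, v ≤ mutInfo P (W θ)) :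
    v ≤ ratesFormula μ W γ P := by
  refine le_trans ?_ ((ratesFormula_le_iff hγ0 hγ hW hP).1 le_rfl Λ hΛ hμ)
  refine le_csInf ((nonempty_of_ofReal_le hγ hμ).image _) ?_
  rintro _ ⟨θ, hθ, rfl⟩
  exact hv θ hθ

theorem measurableSet_lambdaSet [DecidableEq X] [DecidableEq Y]
    (hW : ∀ x y, Measurable fun θ => W θ x y) {n M : ℕ} (c : Fin M → Fin n → X)
    (D : Fin M → Finset (Fin n → Y)) (ε : ℝ) : MeasurableSet (lambdaSet W c D ε) := by
  rw [lambdaSet, Set.ofPred_forall]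
  refine MeasurableSet.iInter fun m => measurableSet_le ?_ measurable_const
  exact Finset.measurable_fun_sum _ fun y _ => Finset.measurable_fun_prod _ fun i _ => hW _ _

/-- Every rate that is `(ε, γ)`-achievable for arbitrarily small `ε` is bounded by any bound on
the rates `ratesFormula μ W γ P` over the admissible input laws. -/
theorem le_of_forall_achievable [MeasureTheory.IsProbabilityMeasure μ] [DecidableEq X]
    [DecidableEq Y] (hγ0 : 0 ≤ γ) (hγ : γ < 1) (hW : ∀ θ, IsChannel (W θ))
    (hWm : ∀ x y, Measurable fun θ => W θ x y) {Γ : X → ℝ} {B R v : ℝ}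
    (h : ∀ ε : ℝ, 0 < ε → ε < 1 → Achievable μ W Γ B γ ε R)
    (hv : ∀ P, IsPM P → ∑ a, Γ a * P a ≤ B → ratesFormula μ W γ P ≤ v) : R ≤ v := by
  have hε (ε : ℝ) (hε0 : 0 < ε) (hε1 : ε < 1) : (1 - ε) * (R - ε) ≤ v := by
    obtain ⟨N, hN⟩ := h ε hε0 hε1 ε hε0
    have hlim : Filter.Tendsto (fun n : ℕ => (1 - ε) * (R - ε) - (n : ℝ)⁻¹ * Real.log 2)
        Filter.atTop (nhds ((1 - ε) * (R - ε))) := by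
      simpa using tendsto_const_nhds.sub
        ((tendsto_inv_atTop_nhds_zero_nat (𝕜 := ℝ)).mul_const (Real.log 2))
    refine le_of_tendsto hlim ?_
    filter_upwards [Filter.eventually_ge_atTop N, Filter.eventually_ge_atTop 1] with n hn hn1
    obtain ⟨M, c, D, hM, hc, hD, hμ, hrate⟩ := hN n hn
    have hn0 : (0 : ℝ) < n := by exact_mod_cast hn1
    have hM0 : (0 : ℝ) < M := by exact_mod_cast hM
    have hPM := isPM_codeLaw hn1 hM c
    refine le_trans ?_ (hv (codeLaw c) hPM ?_)
    · refine le_ratesFormula hγ0 hγ hW hPM (measurableSet_lambdaSet hWm c D ε) hμ fun θ hθ => ?_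
      have h1 := log_card_le_of_error_le (hW θ) hn1 hM c D hD hθ
      calc (1 - ε) * (R - ε) - (n : ℝ)⁻¹ * Real.log 2
          ≤ (1 - ε) * ((n : ℝ)⁻¹ * Real.log M) - (n : ℝ)⁻¹ * Real.log 2 := by
            gcongr
        _ = (n : ℝ)⁻¹ * ((1 - ε) * Real.log M - Real.log 2) := by ring
        _ ≤ (n : ℝ)⁻¹ * (n * mutInfo (codeLaw c) (W θ)) := by
            gcongr
            linarith
        _ = _ := by field_simp
    · rw [sum_mul_codeLaw, inv_mul_le_iff₀ hM0]
      calc _ ≤ ∑ _m : Fin M, B := Finset.sum_le_sum fun m _ => hc m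
        _ = _ := by simp
  have hlim : Filter.Tendsto (fun ε : ℝ => (1 - ε) * (R - ε)) (nhdsWithin 0 (Set.Ioi 0))
      (nhds R) := by
    have : Filter.Tendsto (fun ε : ℝ => (1 - ε) * (R - ε)) (nhds 0) (nhds ((1 - 0) * (R - 0))) :=
      Continuous.tendsto (by fun_prop) 0
    simpa using this.mono_left nhdsWithin_le_nhds
  refine le_of_tendsto hlim ?_
  filter_upwards [Ioo_mem_nhdsGT (show (0 : ℝ) < 1 by norm_num)] with ε h
  exact hε ε h.1 h.2

end RatesFormula

theorem outage_capacity_coding_theorem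
    (X Y Θ : Type) [Fintype X] [Fintype Y] [Nonempty X] [Nonempty Y]
    [DecidableEq X] [DecidableEq Y] [MeasurableSpace Θ]
    (μ : MeasureTheory.Measure Θ) [MeasureTheory.IsProbabilityMeasure μ]
    (W : Θ → X → Y → ℝ) (hW : ∀ θ, IsChannel (W θ))
    (hWmeas : ∀ x y, Measurable fun θ => W θ x y)
    (γ : ℝ) (hγ0 : 0 < γ) (hγ1 : γ < 1)
    (Γ : X → ℝ) (hΓ : ∀ x, 0 ≤ Γ x)
    (Pbudget : ℝ) (hP : Finset.univ.inf' Finset.univ_nonempty Γ ≤ Pbudget) :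
    sSup {R : ℝ | 0 ≤ R ∧ ∀ ε : ℝ, 0 < ε → ε < 1 →
        Achievable μ W Γ Pbudget γ ε R} =
      sSup {v : ℝ | ∃ P : X → ℝ, IsPM P ∧ (∑ a, Γ a * P a) ≤ Pbudget ∧
        v = ratesFormula μ W γ P} := by
  obtain ⟨a₀, -, ha₀⟩ := Finset.exists_mem_eq_inf' Finset.univ_nonempty Γ
  rw [ha₀] at hP
  have hmin (a : X) : Γ a₀ ≤ Γ a := ha₀ ▸ Finset.inf'_le Γ (Finset.mem_univ a)
  have hne : {v : ℝ | ∃ P : X → ℝ, IsPM P ∧ (∑ a, Γ a * P a) ≤ Pbudget ∧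
      v = ratesFormula μ W γ P}.Nonempty := by
    refine ⟨_, Pi.single a₀ 1, ⟨fun a => ?_, by simp⟩, by simpa [Pi.single_apply] using hP, rfl⟩
    rw [Pi.single_apply]
    split_ifs <;> norm_num
  have hbdd : BddAbove {v : ℝ | ∃ P : X → ℝ, IsPM P ∧ (∑ a, Γ a * P a) ≤ Pbudget ∧
      v = ratesFormula μ W γ P} := by
    refine ⟨Fintype.card X * Fintype.card Y, ?_⟩
    rintro _ ⟨P, hPM, -, rfl⟩
    exact (ratesFormula_le_iff hγ0.le hγ1 hW hPM).2 fun Λ _ hμ =>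
      sInf_mutInfo_le_card hγ1 hW hPM hμ
  set S := sSup {v : ℝ | ∃ P : X → ℝ, IsPM P ∧ (∑ a, Γ a * P a) ≤ Pbudget ∧
      v = ratesFormula μ W γ P} with hS
  have hconv : ∀ R ∈ {R : ℝ | 0 ≤ R ∧ ∀ ε : ℝ, 0 < ε → ε < 1 →
      Achievable μ W Γ Pbudget γ ε R}, R ≤ S := fun R hR =>
    le_of_forall_achievable hγ0.le hγ1 hW hWmeas hR.2 fun P hPM hcost =>
      le_csSup hbdd ⟨P, hPM, hcost, rfl⟩
  have hdirect {P : X → ℝ} (hPM : IsPM P) (hcost : ∑ a, Γ a * P a ≤ Pbudget) {Λ : Set Θ}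
      (hμ : ENNReal.ofReal (1 - γ) ≤ μ Λ) {t : ℝ} (ht0 : 0 < t) (ht1 : t < 1) :
      t * sInf ((fun θ => mutInfo P (W θ)) '' Λ) ∈ {R : ℝ | 0 ≤ R ∧ ∀ ε : ℝ, 0 < ε → ε < 1 →
        Achievable μ W Γ Pbudget γ ε R} := by
    refine ⟨mul_nonneg ht0.le (Real.sInf_nonneg ?_), fun ε hε0 hε1 => ?_⟩
    · rintro _ ⟨θ, -, rfl⟩
      exact mutInfo_nonneg hPM (hW θ)
    · exact achievable_mul_of_le_mutInfo μ W hW hPM hcost hP hmin (nonempty_of_ofReal_le hγ1 hμ) hμ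
        (fun θ hθ => sInf_mutInfo_le hW hPM hθ) ht0 ht1 hε0 hε1
  have huniv : ENNReal.ofReal (1 - γ) ≤ μ Set.univ := by
    rw [MeasureTheory.measure_univ]
    exact ENNReal.ofReal_le_one.2 (by linarith)
  refine le_antisymm (csSup_le ?_ hconv) (csSup_le hne ?_)
  · obtain ⟨-, P, hPM, hcost, -⟩ := hne
    exact ⟨_, hdirect hPM hcost huniv one_half_pos one_half_lt_one⟩
  · rintro _ ⟨P, hPM, hcost, rfl⟩
    refine (ratesFormula_le_iff hγ0.le hγ1 hW hPM).2 fun Λ _ hμ => ?_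
    have hlim : Filter.Tendsto (fun t : ℝ => t * sInf ((fun θ => mutInfo P (W θ)) '' Λ))
        (nhdsWithin 1 (Set.Iio 1)) (nhds (sInf ((fun θ => mutInfo P (W θ)) '' Λ))) := by
      have := (Filter.tendsto_id (x := nhds (1 : ℝ))).mul_const
        (sInf ((fun θ => mutInfo P (W θ)) '' Λ))
      simpa using this.mono_left nhdsWithin_le_nhds
    refine le_of_tendsto hlim ?_
    filter_upwards [Ioo_mem_nhdsLT (show (0 : ℝ) < 1 by norm_num)] with t ht
    exact le_csSup ⟨S, hconv⟩ (hdirect hPM hcost hμ ht.1 ht.2)
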